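/- arXiv:math/0506368 — 4 statements merged into one kernel-verified Lean document; each statement's English description precedes it below -/
import Mathlib

section
/- Let β₂, β₃ : [0,∞) → [0,∞) be continuous, R ≥ 0, and let v : [t₀, T) → [0,∞) be lower semicontinuous with D⁺v(t) ≤ β₂(t)·v(t) + R·β₃(t) for all t ∈ [t₀, T). Then v(t) ≤ exp( ∫_{t₀}^t β₂(s) ds ) · ( v(t₀) + R·∫_{t₀}^t β₃(s) ds ) for all t ∈ [t₀, T). -/
open Set Filter MeasureTheory

noncomputable section

/-- The upper right Dini derivative `D⁺v(t) = limsup_{h→0⁺} (v(t+h)-v(t))/h`,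
with values in the extended reals. -/
def DiniUpper (v : ℝ → ℝ) (t : ℝ) : EReal :=
  Filter.limsup (fun h => (((v (t + h) - v t) / h : ℝ) : EReal)) (nhdsWithin 0 (Ioi 0))

/-- A Gronwall-type estimate for lower semicontinuous functions
satisfying the Dini differential inequality `D⁺v(t) ≤ β₂(t) v(t) + R β₃(t)`. -/
theorem stmt5 (β₂ β₃ : ℝ → ℝ)
    (hβ₂cont : ContinuousOn β₂ (Ici 0)) (hβ₂nn : ∀ t, 0 ≤ t → 0 ≤ β₂ t)
    (hβ₃cont : ContinuousOn β₃ (Ici 0)) (hβ₃nn : ∀ t, 0 ≤ t → 0 ≤ β₃ t)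
    (R : ℝ) (hR : 0 ≤ R)
    (t₀ T : ℝ) (ht₀ : 0 ≤ t₀)
    (v : ℝ → ℝ) (hvnn : ∀ t ∈ Ico t₀ T, 0 ≤ v t)
    (hvlsc : ∀ t ∈ Ico t₀ T, ∀ ε > 0, ∃ δ > 0, ∀ s ∈ Ico t₀ T, |s - t| < δ → v t - ε < v s)
    (hvdini : ∀ t ∈ Ico t₀ T, DiniUpper v t ≤ ((β₂ t * v t + R * β₃ t : ℝ) : EReal)) :
    ∀ t ∈ Ico t₀ T,
      v t ≤ Real.exp (∫ s in t₀..t, β₂ s) * (v t₀ + R * ∫ s in t₀..t, β₃ s) := by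
  intro t ht
  let b₂ : ℝ → ℝ := fun s => β₂ (max 0 s)
  let b₃ : ℝ → ℝ := fun s => β₃ (max 0 s)
  have hm : Continuous (fun s : ℝ => max 0 s) := by fun_prop
  have hb₂ : Continuous b₂ := hβ₂cont.comp_continuous hm (fun x => mem_Ici.2 (le_max_left _ _))
  have hb₃ : Continuous b₃ := hβ₃cont.comp_continuous hm (fun x => mem_Ici.2 (le_max_left _ _))
  have e₂ : (∫ s in t₀..t, β₂ s) = ∫ s in t₀..t, b₂ s := by
    apply intervalIntegral.integral_congr
    intro s hs
    rw [uIcc_of_le ht.1] at hs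
    simp only [b₂, max_eq_right (ht₀.trans hs.1)]
  have e₃ : (∫ s in t₀..t, β₃ s) = ∫ s in t₀..t, b₃ s := by
    apply intervalIntegral.integral_congr
    intro s hs
    rw [uIcc_of_le ht.1] at hs
    simp only [b₃, max_eq_right (ht₀.trans hs.1)]
  rw [e₂, e₃]
  let B₂ : ℝ → ℝ := fun x => ∫ s in t₀..x, b₂ s
  let B₃ : ℝ → ℝ := fun x => ∫ s in t₀..x, b₃ s
  have dB₂ : ∀ x, HasDerivAt B₂ (b₂ x) x := fun x => hb₂.integral_hasStrictDerivAt t₀ x |>.hasDerivAt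
  have dB₃ : ∀ x, HasDerivAt B₃ (b₃ x) x := fun x => hb₃.integral_hasStrictDerivAt t₀ x |>.hasDerivAt
  have key : ∀ ε > 0, v t ≤ Real.exp (B₂ t) * (v t₀ + R * B₃ t + ε * (t - t₀)) := by
    intro ε hε
    let ψ : ℝ → ℝ := fun x => Real.exp (B₂ x) * (v t₀ + R * B₃ x + ε * (x - t₀))
    have dψ : ∀ x, HasDerivAt ψ (b₂ x * ψ x + Real.exp (B₂ x) * (R * b₃ x + ε)) x := by
      intro x
      have h1 := (dB₂ x).exp
      have h2 := (((dB₃ x).const_mul R).const_add (v t₀)).add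
        (((hasDerivAt_id x).sub_const t₀).const_mul ε)
      have h3 : HasDerivAt ψ _ x := h1.mul h2
      refine h3.congr_deriv ?_
      simp only [ψ, Pi.add_apply, id]
      ring
    have cψ : Continuous ψ := continuous_iff_continuousAt.2 fun x => (dψ x).continuousAt
    have hcl : IsClosed ({x | v x ≤ ψ x} ∩ Icc t₀ t) := by
      apply isClosed_of_closure_subset
      intro x hx
      have hxI : x ∈ Icc t₀ t :=
        closure_minimal inter_subset_right isClosed_Icc hx
      refine ⟨?_, hxI⟩
      by_contra hlt
      replace hlt : ψ x < v x := not_le.1 hlt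
      obtain ⟨δ, hδ, hv⟩ := hvlsc x ⟨hxI.1, hxI.2.trans_lt ht.2⟩ ((v x - ψ x) / 2) (by linarith)
      obtain ⟨δ', hδ', hp⟩ := Metric.continuousAt_iff.1 cψ.continuousAt ((v x - ψ x) / 2)
        (by linarith)
      obtain ⟨y, hy, hxy⟩ := Metric.mem_closure_iff.1 hx (min δ δ') (lt_min hδ hδ')
      rw [dist_comm] at hxy
      have h1 := hv y ⟨hy.2.1, hy.2.2.trans_lt ht.2⟩ (hxy.trans_le (min_le_left _ _))
      have h2 := hp (hxy.trans_le (min_le_right _ _))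
      rw [Real.dist_eq] at h2
      have h3 := (abs_lt.1 h2).2
      have h4 : v y ≤ ψ y := hy.1
      linarith
    refine hcl.Icc_subset_of_forall_mem_nhdsWithin ?_ ?_ (right_mem_Icc.2 ht.1)
    · simp [ψ, B₂, B₃]
    · rintro x ⟨hxs, hxI⟩
      have hxs : v x ≤ ψ x := hxs
      have hx0 : 0 ≤ x := ht₀.trans hxI.1
      have q₂ : b₂ x = β₂ x := by simp only [b₂, max_eq_right hx0]
      have q₃ : b₃ x = β₃ x := by simp only [b₃, max_eq_right hx0]
      have hB : 0 ≤ B₂ x := intervalIntegral.integral_nonneg hxI.1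
        (fun u _ => hβ₂nn _ (le_max_left _ _))
      have hE : 1 ≤ Real.exp (B₂ x) := Real.one_le_exp hB
      have hd := hvdini x ⟨hxI.1, hxI.2.trans ht.2⟩
      have hlt : DiniUpper v x < ((β₂ x * v x + R * β₃ x + ε / 2 : ℝ) : EReal) :=
        hd.trans_lt (EReal.coe_lt_coe_iff.2 (by linarith))
      have hev := Filter.eventually_lt_of_limsup_lt hlt
      have hD : β₂ x * v x + R * β₃ x + ε / 2 <
          b₂ x * ψ x + Real.exp (B₂ x) * (R * b₃ x + ε) := by
        rw [q₂, q₃]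
        have a1 := mul_le_mul_of_nonneg_left hxs (hβ₂nn x hx0)
        have a2 : 0 ≤ R * β₃ x := mul_nonneg hR (hβ₃nn x hx0)
        nlinarith
      have hs := (hasDerivAt_iff_tendsto_slope_zero.1 (dψ x)).mono_left
        (nhdsWithin_mono 0 (fun y (hy : y ∈ Ioi (0:ℝ)) => ne_of_gt hy))
      have hev2 := hs.eventually (lt_mem_nhds hD)
      have hall : ∀ᶠ h in nhdsWithin (0:ℝ) (Ioi 0), v (x + h) ≤ ψ (x + h) := by
        filter_upwards [hev, hev2, self_mem_nhdsWithin] with h h1 h2 h3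
        have h3 : 0 < h := h3
        have h1 := EReal.coe_lt_coe_iff.1 h1
        rw [smul_eq_mul, inv_mul_eq_div] at h2
        have h4 := h1.trans h2
        rw [div_lt_div_iff_of_pos_right h3] at h4
        linarith
      have hsh : Tendsto (fun y => y - x) (nhdsWithin x (Ioi x)) (nhdsWithin 0 (Ioi 0)) := by
        apply tendsto_nhdsWithin_of_tendsto_nhds_of_eventually_within
        · have : Tendsto (fun y => y - x) (nhds x) (nhds (x - x)) :=
            (continuous_id.sub continuous_const).tendsto x
          rw [sub_self] at this
          exact this.mono_left nhdsWithin_le_nhds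
        · filter_upwards [self_mem_nhdsWithin] with y hy
          exact mem_Ioi.2 (sub_pos.2 (mem_Ioi.1 hy))
      filter_upwards [hsh.eventually hall] with y hy
      simpa using hy
  have hlim : Tendsto (fun ε : ℝ => Real.exp (B₂ t) * (v t₀ + R * B₃ t + ε * (t - t₀)))
      (nhdsWithin 0 (Ioi 0)) (nhds (Real.exp (B₂ t) * (v t₀ + R * B₃ t + 0 * (t - t₀)))) := by
    apply Tendsto.mono_left _ nhdsWithin_le_nhds
    apply Continuous.tendsto (f := fun ε : ℝ => Real.exp (B₂ t) * (v t₀ + R * B₃ t + ε * (t - t₀)))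
    fun_prop
  have := ge_of_tendsto hlim (by filter_upwards [self_mem_nhdsWithin] with ε hε using key ε hε)
  simpa using this

end
end

section
/- (Example 2.12) Let 0 < a ≤ b and r ≥ 0 with 2b³r² < a. Consider the scalar delay equation ẋ(t) = −d(t)x(t−r) with d ∈ M_{[a,b]}. Then 0 is URGAS: there exists σ ∈ KL such that for every t₀ ≥ 0, every d ∈ M_{[a,b]} and every continuous x : [t₀−r, ∞) → ℝ which is absolutely continuous on compact subintervals of [t₀,∞) and satisfies ẋ(t) = −d(t)x(t−r) for almost every t ≥ t₀, one has max_{θ∈[−r,0]} |x(t+θ)| ≤ σ( max_{θ∈[−r,0]} |x(t₀+θ)|, t−t₀ ) for all t ≥ t₀. -/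
open Set Filter MeasureTheory

noncomputable section

/-- The class `M_D` of allowed disturbances (scalar case): right-continuous maps
`d : [0,∞) → D` which are continuous outside a countable set with no finite
accumulation point. -/
def MDs (D : Set ℝ) (d : ℝ → ℝ) : Prop :=
  (∀ t, 0 ≤ t → d t ∈ D) ∧
  (∀ t, 0 ≤ t → ∀ ε > 0, ∃ δ > 0, ∀ s, t ≤ s → s - t < δ → |d s - d t| < ε) ∧
  ∃ A : Set ℝ, (∀ C : ℝ, (A ∩ Icc 0 C).Finite) ∧
    ∀ t, 0 ≤ t → t ∉ A → ∀ ε > 0, ∃ δ > 0, ∀ s, 0 ≤ s → |s - t| < δ → |d s - d t| < ε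

/-- Class `K⁺`: positive continuous functions on `[0,∞)`. -/
def IsKPlus (b : ℝ → ℝ) : Prop :=
  ContinuousOn b (Ici 0) ∧ ∀ t, 0 ≤ t → 0 < b t

/-- Class `KL` functions. -/
def IsKL (σ : ℝ → ℝ → ℝ) : Prop :=
  ContinuousOn (fun p : ℝ × ℝ => σ p.1 p.2) (Ici 0 ×ˢ Ici 0) ∧
  (∀ s t, 0 ≤ s → 0 ≤ t → 0 ≤ σ s t) ∧
  (∀ t, 0 ≤ t → StrictMonoOn (fun s => σ s t) (Ici 0) ∧ σ 0 t = 0) ∧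
  (∀ s, 0 ≤ s → AntitoneOn (σ s) (Ici 0)) ∧
  (∀ s, 0 ≤ s → Filter.Tendsto (σ s) Filter.atTop (nhds 0))

theorem aux_diff (d x : ℝ → ℝ) (t₀ r : ℝ)
    (hx : ∀ t, t₀ ≤ t →
            IntervalIntegrable (fun s => -(d s) * x (s - r)) volume t₀ t ∧
            x t = x t₀ + ∫ s in t₀..t, -(d s) * x (s - r)) (u v : ℝ) (hu : t₀ ≤ u) (hv : t₀ ≤ v) :
    IntervalIntegrable (fun s => -(d s) * x (s - r)) volume u v ∧
    x v - x u = ∫ s in u..v, -(d s) * x (s - r) := by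
  obtain ⟨h1, h2⟩ := hx u hu
  obtain ⟨h3, h4⟩ := hx v hv
  refine ⟨h1.symm.trans h3, ?_⟩
  rw [h2, h4, ← intervalIntegral.integral_interval_sub_left h3 h1]
  ring

theorem aux_core (a b r t₀ l K t1 : ℝ) (ha : 0 < a) (hr : 0 ≤ r) (hl : 0 < l)
    (hK : 0 < K) (hlam : l < a * (1 - b * r * Real.exp (2 * l * r)))
    (ht₀ : 0 ≤ t₀) (d x : ℝ → ℝ) (hd : ∀ t, 0 ≤ t → d t ∈ Icc a b)
    (hc : ContinuousOn x (Ici (t₀ - r)))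
    (hx : ∀ t, t₀ ≤ t →
            IntervalIntegrable (fun s => -(d s) * x (s - r)) volume t₀ t ∧
            x t = x t₀ + ∫ s in t₀..t, -(d s) * x (s - r))
    (ht1 : t₀ + r < t1)
    (hlt : ∀ s, t₀ - r ≤ s → s < t1 → |x s| ≤ K * Real.exp (-l * (s - t₀ - r)))
    (hge : K * Real.exp (-l * (t1 - t₀ - r)) ≤ x t1) : False := by
  set w : ℝ → ℝ := fun s => K * Real.exp (-l * (s - t₀ - r)) with hw
  have hwpos : ∀ s, 0 < w s := fun s => by simp only [hw]; positivity
  have hbpos : 0 < b := by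
    have := hd 0 le_rfl
    exact lt_of_lt_of_le ha (this.1.trans this.2)
  set q := b * r * Real.exp (2 * l * r) with hq
  have hge' : w t1 ≤ x t1 := hge
  have hlt' : ∀ s, t₀ - r ≤ s → s < t1 → |x s| ≤ w s := hlt
  -- lower bound for x (t1 - r)
  have h1 : (1 - q) * w t1 ≤ x (t1 - r) := by
    rcases hr.eq_or_lt with h0 | hrpos
    · subst h0; simp [hq]; exact hge'
    obtain ⟨-, he⟩ := aux_diff d x t₀ r hx (t1 - r) t1 (by linarith) (by linarith)
    have hb : ‖∫ s in (t1 - r)..t1, -(d s) * x (s - r)‖ ≤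
        (b * w (t1 - 2 * r)) * |t1 - (t1 - r)| := by
      apply intervalIntegral.norm_integral_le_of_norm_le_const
      intro s hs
      rw [uIoc_of_le (by linarith)] at hs
      obtain ⟨hs1, hs2⟩ := hs
      have hds := hd s (by linarith)
      rw [Real.norm_eq_abs, abs_mul, abs_neg, abs_of_pos (lt_of_lt_of_le ha hds.1)]
      have h3 := hlt' (s - r) (by linarith) (by linarith)
      have h4 : w (s - r) ≤ w (t1 - 2 * r) := by
        simp only [hw]
        apply mul_le_mul_of_nonneg_left _ hK.le
        apply Real.exp_le_exp.2
        nlinarith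
      exact mul_le_mul hds.2 (h3.trans h4) (abs_nonneg _) hbpos.le
    have h5 : w (t1 - 2 * r) = w t1 * Real.exp (2 * l * r) := by
      simp only [hw]
      rw [mul_assoc, ← Real.exp_add]
      congr 2; ring
    rw [← he, Real.norm_eq_abs, sub_sub_cancel, abs_of_pos hrpos, h5] at hb
    have := (abs_le.1 hb).2
    have h6 : b * (w t1 * Real.exp (2 * l * r)) * r = q * w t1 := by rw [hq]; ring
    linarith
  -- choose c
  obtain ⟨c, hc1, hc2⟩ : ∃ c, l * w t1 < a * c ∧ c < (1 - q) * w t1 := by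
    have h2 : l * w t1 / a < (1 - q) * w t1 := by
      rw [div_lt_iff₀ ha]
      have := mul_lt_mul_of_pos_right hlam (hwpos t1)
      linarith
    obtain ⟨c, hc1, hc2⟩ := exists_between h2
    refine ⟨c, ?_, hc2⟩
    rw [div_lt_iff₀ ha] at hc1
    linarith
  have hcpos : 0 < c := by
    have := mul_pos hl (hwpos t1)
    by_contra hcon
    nlinarith
  have hca : ContinuousAt (fun s => x (s - r)) t1 := by
    have : ContinuousAt x (t1 - r) := hc.continuousAt (Ici_mem_nhds (by linarith))
    exact ContinuousAt.comp (f := fun s => s - r) this (by fun_prop)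
  have hcw : ContinuousAt (fun s => l * w s) t1 := by simp only [hw]; fun_prop
  have e1 : ∀ᶠ s in nhds t1, c < x (s - r) :=
    hca.eventually (lt_mem_nhds (lt_of_lt_of_le hc2 h1))
  have e2 : ∀ᶠ s in nhds t1, l * w s < a * c := hcw.eventually (gt_mem_nhds hc1)
  obtain ⟨δ, hδ, hball⟩ := Metric.eventually_nhds_iff.1 (e1.and e2)
  set u := max (t1 - δ / 2) (t₀ + r) with hu
  have hu1 : u < t1 := max_lt (by linarith) ht1
  have hu2 : t1 - δ / 2 ≤ u := le_max_left _ _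
  have hu3 : t₀ + r ≤ u := le_max_right _ _
  have hin : ∀ s, u ≤ s → s ≤ t1 → c < x (s - r) ∧ l * w s < a * c := by
    intro s h1 h2
    apply hball
    rw [Real.dist_eq, abs_lt]
    constructor <;> linarith
  obtain ⟨hint, he⟩ := aux_diff d x t₀ r hx u t1 (by linarith) (by linarith)
  have hmono : ∫ s in u..t1, -(d s) * x (s - r) ≤ ∫ s in u..t1, -(a * c) := by
    apply intervalIntegral.integral_mono_on hu1.le hint (by simp)
    intro s hs
    have h7 := (hin s hs.1 hs.2).1
    have hds := (hd s (by linarith [hs.1])).1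
    have := mul_le_mul hds h7.le hcpos.le (ha.le.trans hds)
    linarith
  rw [← he, intervalIntegral.integral_const, smul_eq_mul] at hmono
  have h8 : w t1 = w u * Real.exp (-l * (t1 - u)) := by
    simp only [hw]
    rw [mul_assoc, ← Real.exp_add]
    congr 2; ring
  have h9 := Real.add_one_le_exp (-l * (t1 - u))
  have h10 := mul_le_mul_of_nonneg_left h9 (hwpos u).le
  rw [← h8] at h10
  have h11 := mul_lt_mul_of_pos_right (hin u le_rfl hu1.le).2 (sub_pos.2 hu1)
  have h12 := (abs_le.1 (hlt' u (by linarith) hu1)).2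
  linarith

theorem aux_bound (a b r t₀ l K S : ℝ) (ha : 0 < a) (hr : 0 ≤ r) (hl : 0 < l)
    (hlam : l < a * (1 - b * r * Real.exp (2 * l * r))) (hbr : b * r ≤ 1)
    (ht₀ : 0 ≤ t₀) (d x : ℝ → ℝ) (hd : ∀ t, 0 ≤ t → d t ∈ Icc a b)
    (hc : ContinuousOn x (Ici (t₀ - r)))
    (hx : ∀ t, t₀ ≤ t →
            IntervalIntegrable (fun s => -(d s) * x (s - r)) volume t₀ t ∧
            x t = x t₀ + ∫ s in t₀..t, -(d s) * x (s - r))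
    (hS : ∀ s, t₀ - r ≤ s → s ≤ t₀ → |x s| ≤ S) (hKS : 2 * S < K) (t : ℝ) (ht : t₀ - r ≤ t) :
    |x t| < K * Real.exp (-l * (t - t₀ - r)) := by
  have hS0 : 0 ≤ S := (abs_nonneg _).trans (hS t₀ (by linarith) le_rfl)
  have hK : 0 < K := by linarith
  have hbpos : 0 < b := by
    have := hd 0 le_rfl
    exact lt_of_lt_of_le ha (this.1.trans this.2)
  have hinit : ∀ s, t₀ - r ≤ s → s ≤ t₀ + r → |x s| ≤ 2 * S := by
    intro s hs1 hs2
    rcases le_total s t₀ with h | h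
    · linarith [hS s hs1 h]
    have he := (hx s h).2
    have hb : ‖∫ s in t₀..s, -(d s) * x (s - r)‖ ≤ (b * S) * |s - t₀| := by
      apply intervalIntegral.norm_integral_le_of_norm_le_const
      intro v hv
      rw [uIoc_of_le h] at hv
      obtain ⟨hv1, hv2⟩ := hv
      have hds := hd v (by linarith)
      rw [Real.norm_eq_abs, abs_mul, abs_neg, abs_of_pos (lt_of_lt_of_le ha hds.1)]
      exact mul_le_mul hds.2 (hS _ (by linarith) (by linarith)) (abs_nonneg _) hbpos.le
    rw [abs_of_nonneg (sub_nonneg.2 h), Real.norm_eq_abs] at hb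
    have h2 : b * S * (s - t₀) ≤ b * S * r :=
      mul_le_mul_of_nonneg_left (by linarith) (by positivity)
    have h3 : b * S * r ≤ S := by nlinarith
    have h4 := hS t₀ (by linarith) le_rfl
    rw [he]
    exact (abs_add_le _ _).trans (by linarith)
  by_contra hcon
  push Not at hcon
  set V : Set ℝ := Ici (t₀ - r) ∩ {s | K * Real.exp (-l * (s - t₀ - r)) - |x s| ≤ 0} with hV
  have hVc : IsClosed V := by
    have hcont : ContinuousOn (fun s => K * Real.exp (-l * (s - t₀ - r)) - |x s|)
        (Ici (t₀ - r)) := by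
      apply ContinuousOn.sub (by fun_prop) hc.abs
    exact hcont.preimage_isClosed_of_isClosed isClosed_Ici isClosed_Iic
  have hVb : BddBelow V := ⟨t₀ - r, fun s hs => hs.1⟩
  have hVn : V.Nonempty := ⟨t, ht, by simp only [mem_setOf_eq]; linarith⟩
  have hm := hVc.csInf_mem hVn hVb
  set t1 := sInf V with ht1
  obtain ⟨hm1, hm2⟩ := hm
  simp only [mem_setOf_eq, mem_Ici] at hm1 hm2
  have hbelow : ∀ s, t₀ - r ≤ s → s < t1 → |x s| ≤ K * Real.exp (-l * (s - t₀ - r)) := by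
    intro s h1 h2
    by_contra h3
    push Not at h3
    have : s ∈ V := ⟨h1, by simp only [mem_setOf_eq]; linarith⟩
    linarith [csInf_le hVb this]
  have hgt : t₀ + r < t1 := by
    by_contra h
    push Not at h
    have h1 := hinit t1 hm1 h
    have h2 : 1 ≤ Real.exp (-l * (t1 - t₀ - r)) := by
      apply Real.one_le_exp; nlinarith
    nlinarith
  rcases le_total 0 (x t1) with h | h
  · rw [abs_of_nonneg h] at hm2
    exact aux_core a b r t₀ l K t1 ha hr hl hK hlam ht₀ d x hd hc hx hgt hbelow (by linarith)
  · rw [abs_of_nonpos h] at hm2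
    refine aux_core a b r t₀ l K t1 ha hr hl hK hlam ht₀ d (fun s => - x s) hd hc.neg ?_ hgt
      (fun s h1 h2 => by simpa only [abs_neg] using hbelow s h1 h2) (by linarith)
    intro t ht
    obtain ⟨h1, h2⟩ := hx t ht
    have h3 : (fun s => -(d s) * -x (s - r)) = fun s => -(-(d s) * x (s - r)) := by
      funext s; ring
    rw [h3, intervalIntegral.integral_neg, h2]
    exact ⟨h1.neg, by ring⟩

theorem aux_KL (C l : ℝ) (hC : 0 < C) (hl : 0 < l) :
    IsKL (fun s t => C * s * Real.exp (-l * t)) := by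
  refine ⟨by fun_prop, fun s t hs ht => by positivity, fun t ht => ⟨?_, by simp⟩, ?_, ?_⟩
  · intro s _ s' _ h
    show C * s * _ < C * s' * _
    gcongr
  · intro s hs t _ t' _ h
    show C * s * _ ≤ C * s * _
    apply mul_le_mul_of_nonneg_left _ (by positivity)
    apply Real.exp_le_exp.2
    nlinarith
  · intro s hs
    have h1 : Tendsto (fun t : ℝ => -l * t) atTop atBot :=
      tendsto_id.const_mul_atTop_of_neg (by linarith)
    have := (Real.tendsto_exp_atBot.comp h1).const_mul (C * s)
    simpa using this

/-- **Example 2.12.** If `0 < a ≤ b`, `r ≥ 0` and `2b³r² < a`, then `0` is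
URGAS for the scalar delay equation `ẋ(t) = -d(t) x(t-r)`, `d ∈ M_{[a,b]}`. -/
theorem stmt13 (a b r : ℝ) (ha : 0 < a) (hab : a ≤ b) (hr : 0 ≤ r)
    (hcond : 2 * b ^ 3 * r ^ 2 < a) :
    ∃ σ : ℝ → ℝ → ℝ, IsKL σ ∧
      ∀ t₀ : ℝ, 0 ≤ t₀ → ∀ d : ℝ → ℝ, MDs (Icc a b) d →
        ∀ x : ℝ → ℝ, ContinuousOn x (Ici (t₀ - r)) →
          (∀ t, t₀ ≤ t →
            IntervalIntegrable (fun s => -(d s) * x (s - r)) volume t₀ t ∧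
            x t = x t₀ + ∫ s in t₀..t, -(d s) * x (s - r)) →
          ∀ t, t₀ ≤ t →
            sSup ((fun θ => |x (t + θ)|) '' Icc (-r) 0) ≤
              σ (sSup ((fun θ => |x (t₀ + θ)|) '' Icc (-r) 0)) (t - t₀) := by
  have hb : 0 < b := ha.trans_le hab
  have hbr : b * r < 1 := by
    have h1 : b * (2 * (b * r) ^ 2) < b * 1 := by nlinarith
    have h2 := lt_of_mul_lt_mul_left h1 hb.le
    nlinarith
  obtain ⟨l, hl, hlam⟩ : ∃ l, 0 < l ∧ l < a * (1 - b * r * Real.exp (2 * l * r)) := by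
    have hcont : ContinuousAt (fun l => a * (1 - b * r * Real.exp (2 * l * r)) - l) 0 := by
      fun_prop
    have hpos : 0 < a * (1 - b * r * Real.exp (2 * 0 * r)) - 0 := by
      simp; exact mul_pos ha (by linarith)
    have e := hcont.eventually (lt_mem_nhds hpos)
    obtain ⟨δ, hδ, h⟩ := Metric.eventually_nhds_iff.1 e
    refine ⟨δ / 2, by linarith, ?_⟩
    have := h (y := δ / 2) (by rw [Real.dist_eq, abs_lt]; constructor <;> linarith)
    linarith
  refine ⟨_, aux_KL (2 * Real.exp (2 * l * r)) l (by positivity) hl, ?_⟩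
  intro t₀ ht₀ d hd x hc hx t ht
  set S := sSup ((fun θ => |x (t₀ + θ)|) '' Icc (-r) 0) with hSdef
  have hbdd : BddAbove ((fun θ => |x (t₀ + θ)|) '' Icc (-r) 0) := by
    apply IsCompact.bddAbove
    apply isCompact_Icc.image_of_continuousOn
    apply ContinuousOn.abs
    apply hc.comp (by fun_prop)
    intro θ hθ
    simp only [mem_Ici]
    linarith [hθ.1]
  have hS : ∀ s, t₀ - r ≤ s → s ≤ t₀ → |x s| ≤ S := by
    intro s h1 h2
    apply le_csSup hbdd
    refine ⟨s - t₀, ⟨by linarith, by linarith⟩, ?_⟩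
    simp
  have hS0 : 0 ≤ S := (abs_nonneg _).trans (hS t₀ (by linarith) le_rfl)
  apply csSup_le ((nonempty_Icc.2 (by linarith)).image _)
  rintro _ ⟨θ, ⟨hθ1, hθ2⟩, rfl⟩
  have hfin : |x (t + θ)| ≤ 2 * S * Real.exp (-l * (t + θ - t₀ - r)) := by
    rw [← div_le_iff₀ (Real.exp_pos _)]
    apply le_of_forall_gt_imp_ge_of_dense
    intro K hK
    rw [div_le_iff₀ (Real.exp_pos _)]
    exact (aux_bound a b r t₀ l K S ha hr hl hlam hbr.le ht₀ d x hd.1 hc hx hS hK (t + θ)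
      (by linarith)).le
  refine hfin.trans ?_
  have h1 : 2 * Real.exp (2 * l * r) * S * Real.exp (-l * (t - t₀)) =
      2 * S * Real.exp (2 * l * r + -l * (t - t₀)) := by
    rw [Real.exp_add]; ring
  show _ ≤ 2 * Real.exp (2 * l * r) * S * Real.exp (-l * (t - t₀))
  rw [h1]
  apply mul_le_mul_of_nonneg_left _ (by positivity)
  apply Real.exp_le_exp.2
  nlinarith

end
end

section
/- (Example 2.13) Define a : [0,∞) → [0,∞) by a(t) := 2 sin²(πt) for t ∈ [2k, 2k+1] (k a non-negative integer) and a(t) := 0 for t ∈ (2k−1, 2k). Consider the planar system ẋ(t) = −a(t)x(t−1), ẏ(t) = −y(t) + d(t)eᵗ x(t)², with d ∈ M_{[−1,1]}. Then 0 ∈ C([−1,0]; ℝ²) is non-uniformly in time RGAS: there exist σ ∈ KL and β ∈ K⁺ such that for every t₀ ≥ 0, every d ∈ M_{[−1,1]} and every continuous (x,y) : [t₀−1, ∞) → ℝ², absolutely continuous on compact subintervals of [t₀,∞) and satisfying the system for almost every t ≥ t₀, one has max_{θ∈[−1,0]} |(x(t+θ), y(t+θ))| ≤ σ( β(t₀)·max_{θ∈[−1,0]}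 |(x(t₀+θ), y(t₀+θ))|, t−t₀ ) for all t ≥ t₀. -/
open Set Filter MeasureTheory

noncomputable section

open Classical in
/-- The time-varying gain `a(t)` of Example 2.13: `a(t) = 2 sin²(π t)` for
`t ∈ [2k, 2k+1]` (`k` a non-negative integer) and `a(t) = 0` otherwise. -/
def afun (t : ℝ) : ℝ :=
  if ∃ k : ℕ, (2 * k : ℝ) ≤ t ∧ t ≤ 2 * k + 1 then 2 * (Real.sin (Real.pi * t))^2 else 0


lemma aux_y (y : ℝ → ℝ) (a b C : ℝ) (hC : 0 ≤ C) (hy : ContinuousOn y (Ici a))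
    (h : ∀ t ∈ Icc a b, |y t - (y a - ∫ s in a..t, y s)| ≤ C) :
    ∀ t ∈ Icc a b, |y t| ≤ Real.exp (-(t - a)) * |y a| + 2 * C := by
  set Y : ℝ → ℝ := fun s => y (max s a) with hYdef
  have hY : Continuous Y := by
    have : Continuous (fun s : ℝ => max s a) := by fun_prop
    exact hy.comp_continuous this (fun s => mem_Ici.2 (le_max_right _ _))
  have hint : ∀ t, a ≤ t → ∫ s in a..t, y s = ∫ s in a..t, Y s := by
    intro t ht
    apply intervalIntegral.integral_congr
    intro s hs
    rw [uIcc_of_le ht] at hs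
    simp [hYdef, hs.1]
  set z : ℝ → ℝ := fun t => y a - ∫ s in a..t, Y s with hz
  have hzd : ∀ t, HasDerivAt z (-(Y t)) t := by
    intro t
    have := (hY.integral_hasStrictDerivAt a t).hasDerivAt
    simpa [hz] using this.const_sub (y a)
  have hfd : ∀ t, HasDerivAt (fun t => Real.exp t * z t)
      (Real.exp t * z t + Real.exp t * (-(Y t))) t := fun t =>
    (Real.hasDerivAt_exp t).mul (hzd t)
  have key := image_norm_le_of_norm_deriv_right_le_deriv_boundary
    (f := fun t => Real.exp t * z t)
    (f' := fun t => Real.exp t * z t + Real.exp t * (-(Y t))) (a := a) (b := b)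
    (B := fun t => Real.exp a * |y a| + C * (Real.exp t - Real.exp a))
    (B' := fun t => C * Real.exp t)
    (fun t _ => (hfd t).continuousAt.continuousWithinAt)
    (fun t _ => (hfd t).hasDerivWithinAt)
    (by simp [hz, abs_mul])
    (fun t => by
      simpa using (((Real.hasDerivAt_exp t).sub_const (Real.exp a)).const_mul C).const_add
        (Real.exp a * |y a|))
    (by
      intro t ht
      have h1 := h t ⟨ht.1, ht.2.le⟩
      rw [hint t ht.1] at h1
      have h2 : Y t = y t := by simp [hYdef, ht.1]
      have h3 : Real.exp t * z t + Real.exp t * (-(Y t)) = - (Real.exp t * (y t - z t)) := by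
        rw [h2]; ring
      rw [h3, norm_neg, Real.norm_eq_abs, abs_mul, abs_of_pos (Real.exp_pos t), mul_comm]
      exact mul_le_mul_of_nonneg_right h1 (Real.exp_pos t).le)
  intro t ht
  have h1 := h t ht
  rw [hint t ht.1] at h1
  have h2 := key ht
  simp only [Real.norm_eq_abs, abs_mul, Real.abs_exp] at h2
  have h3 : |z t| ≤ Real.exp (-(t - a)) * |y a| + C := by
    have e1 : Real.exp (-(t - a)) = Real.exp a / Real.exp t := by
      rw [← Real.exp_sub]; congr 1; ring
    have hp := Real.exp_pos t
    have : |z t| ≤ (Real.exp a * |y a| + C * (Real.exp t - Real.exp a)) / Real.exp t := by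
      rw [le_div_iff₀ hp]; linarith
    refine this.trans ?_
    rw [e1, div_le_iff₀ hp]
    have : (Real.exp a / Real.exp t * |y a| + C) * Real.exp t
        = Real.exp a * |y a| + C * Real.exp t := by field_simp
    rw [this]
    nlinarith [Real.exp_pos a, mul_nonneg hC (Real.exp_pos a).le]
  have h4 : |y t| ≤ |y t - z t| + |z t| := by
    have := abs_add_le (y t - z t) (z t)
    simpa using this
  have h5 : |y t - z t| ≤ C := h1
  linarith

lemma afun_nonneg (t : ℝ) : 0 ≤ afun t := by
  unfold afun; split_ifs <;> positivity

lemma afun_le (t : ℝ) : afun t ≤ 2 := by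
  unfold afun; split_ifs
  · have := Real.sin_sq_le_one (Real.pi * t); linarith
  · norm_num

lemma afun_zero (k : ℕ) (t : ℝ) (h1 : (2 * k + 1 : ℝ) ≤ t) (h2 : t ≤ 2 * k + 2) :
    afun t = 0 := by
  unfold afun
  split_ifs with h
  · obtain ⟨j, hj1, hj2⟩ := h
    have ha : j ≤ k + 1 := by
      have : (2 * j : ℝ) ≤ 2 * k + 2 := by linarith
      have : 2 * j ≤ 2 * k + 2 := by exact_mod_cast this
      omega
    have hb : k ≤ j := by
      have : (2 * k + 1 : ℝ) ≤ 2 * j + 1 := by linarith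
      have : 2 * k + 1 ≤ 2 * j + 1 := by exact_mod_cast this
      omega
    have hs : ∃ n : ℕ, t = n := by
      rcases Nat.lt_or_ge k j with hc | hc
      · have : j = k + 1 := by omega
        subst this
        push_cast at hj1
        exact ⟨2 * k + 2, by push_cast; linarith⟩
      · have : j = k := by omega
        subst this
        exact ⟨2 * j + 1, by push_cast; linarith⟩
    obtain ⟨n, rfl⟩ := hs
    rw [mul_comm Real.pi, Real.sin_nat_mul_pi]; simp
  · rfl

lemma afun_eq (k : ℕ) (t : ℝ) (h1 : (2 * k : ℝ) ≤ t) (h2 : t ≤ 2 * k + 1) :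
    afun t = 2 * (Real.sin (Real.pi * t))^2 := by
  unfold afun
  rw [if_pos ⟨k, h1, h2⟩]

lemma sin_int (k : ℕ) : ∫ s in (2 * k : ℝ)..(2 * k + 1), 2 * (Real.sin (Real.pi * s))^2 = 1 := by
  have hd : ∀ s ∈ uIcc (2 * k : ℝ) (2 * k + 1),
      HasDerivAt (fun s : ℝ => s - Real.sin (2 * Real.pi * s) / (2 * Real.pi))
      (2 * (Real.sin (Real.pi * s))^2) s := by
    intro s _
    have h1 : HasDerivAt (fun s : ℝ => Real.sin (2 * Real.pi * s))
        (Real.cos (2 * Real.pi * s) * (2 * Real.pi)) s := by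
      have : HasDerivAt (fun s : ℝ => 2 * Real.pi * s) (2 * Real.pi) s := by
        simpa using (hasDerivAt_id s).const_mul (2 * Real.pi)
      exact this.sin
    have h2 := (hasDerivAt_id s).sub (h1.div_const (2 * Real.pi))
    refine h2.congr_deriv ?_
    have : 2 * Real.pi * s = 2 * (Real.pi * s) := by ring
    have hpi := Real.pi_ne_zero
    rw [this, Real.cos_two_mul, mul_div_assoc, div_self (by positivity), Real.sin_sq]
    ring
  rw [intervalIntegral.integral_eq_sub_of_hasDerivAt hd
    (Continuous.intervalIntegrable (by fun_prop) _ _)]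
  have e1 : Real.sin (2 * Real.pi * (2 * k + 1)) = 0 := by
    have := Real.sin_nat_mul_pi (2 * (2 * k + 1))
    push_cast at this
    rw [← this]; congr 1; ring
  have e2 : Real.sin (2 * Real.pi * (2 * k)) = 0 := by
    have := Real.sin_nat_mul_pi (2 * (2 * k))
    push_cast at this
    rw [← this]; congr 1; ring
  rw [e1, e2]; ring

lemma x_step (x : ℝ → ℝ) (t₀ : ℝ)
    (hx : ∀ t, t₀ ≤ t →
            IntervalIntegrable (fun s => -(afun s) * x (s - 1)) volume t₀ t ∧
            x t = x t₀ + ∫ s in t₀..t, -(afun s) * x (s - 1))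
    (u t : ℝ) (hu : t₀ ≤ u) (ht : u ≤ t) :
    x t = x u + ∫ s in u..t, -(afun s) * x (s - 1) := by
  have h1 := hx u hu
  have h2 := hx t (hu.trans ht)
  rw [h2.2, h1.2, ← intervalIntegral.integral_add_adjacent_intervals h1.1
    (h1.1.symm.trans h2.1)]
  ring

lemma x_bound (x : ℝ → ℝ) (t₀ M : ℝ) (hM : 0 ≤ M)
    (hx : ∀ t, t₀ ≤ t →
            IntervalIntegrable (fun s => -(afun s) * x (s - 1)) volume t₀ t ∧
            x t = x t₀ + ∫ s in t₀..t, -(afun s) * x (s - 1))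
    (h0 : ∀ t ∈ Icc (t₀ - 1) t₀, |x t| ≤ M) (n : ℕ) :
    ∀ t ∈ Icc (t₀ - 1) (t₀ + n), |x t| ≤ 3 ^ n * M := by
  induction n with
  | zero => simpa using h0
  | succ n ih =>
    intro t ht
    have hn : (0 : ℝ) ≤ n := n.cast_nonneg
    have hp : 0 ≤ 3 ^ n * M := by positivity
    have e3 : (3 : ℝ) ^ (n + 1) * M = 3 * (3 ^ n * M) := by ring
    rw [e3]
    rcases le_total t (t₀ + n) with h | h
    · have := ih t ⟨ht.1, h⟩
      linarith
    · have h2 := ht.2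
      push_cast at h2
      rw [x_step x t₀ hx (t₀ + n) t (by linarith) h]
      have b1 := ih (t₀ + n) ⟨by linarith, le_rfl⟩
      have b2 : ‖∫ s in (t₀ + n)..t, -(afun s) * x (s - 1)‖
          ≤ (2 * (3 ^ n * M)) * |t - (t₀ + n)| := by
        apply intervalIntegral.norm_integral_le_of_norm_le_const
        intro s hs
        rw [uIoc_of_le h] at hs
        rw [norm_mul, norm_neg, Real.norm_eq_abs, Real.norm_eq_abs, abs_of_nonneg (afun_nonneg s)]
        have := ih (s - 1) ⟨by linarith [hs.1], by linarith [hs.2]⟩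
        exact mul_le_mul (afun_le s) this (abs_nonneg _) (by norm_num)
      rw [Real.norm_eq_abs, abs_of_nonneg (by linarith : 0 ≤ t - (t₀ + n))] at b2
      have b3 := abs_add_le (x (t₀ + n)) (∫ s in (t₀ + n)..t, -(afun s) * x (s - 1))
      nlinarith

lemma x_zero (x : ℝ → ℝ) (t₀ : ℝ) (ht₀ : 0 ≤ t₀)
    (hx : ∀ t, t₀ ≤ t →
            IntervalIntegrable (fun s => -(afun s) * x (s - 1)) volume t₀ t ∧
            x t = x t₀ + ∫ s in t₀..t, -(afun s) * x (s - 1)) :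
    ∀ t, t₀ + 4 ≤ t → x t = 0 := by
  obtain ⟨k, hk1, hk2⟩ : ∃ k : ℕ, t₀ ≤ 2 * k + 1 ∧ (2 * k + 1 : ℝ) ≤ t₀ + 2 := by
    rcases le_total t₀ 1 with h | h
    · exact ⟨0, by simpa using h, by push_cast; linarith⟩
    · refine ⟨⌈(t₀ - 1) / 2⌉₊, ?_, ?_⟩
      · have := Nat.le_ceil ((t₀ - 1) / 2); linarith
      · have := Nat.ceil_lt_add_one (a := (t₀ - 1) / 2) (by linarith); linarith
  have hflat : ∀ (m : ℕ), t₀ ≤ 2 * m + 1 → ∀ t ∈ Icc (2 * m + 1 : ℝ) (2 * m + 2),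
      x t = x (2 * m + 1) := by
    intro m hm t ht
    rw [x_step x t₀ hx (2 * m + 1) t hm ht.1]
    have : ∫ s in (2 * m + 1 : ℝ)..t, -(afun s) * x (s - 1) = ∫ s in (2 * m + 1 : ℝ)..t, (0 : ℝ) := by
      apply intervalIntegral.integral_congr
      intro s hs
      rw [uIcc_of_le ht.1] at hs
      simp [afun_zero m s hs.1 (hs.2.trans ht.2)]
    rw [this]; simp
  have h3 : x (2 * k + 3) = 0 := by
    rw [x_step x t₀ hx (2 * k + 2) (2 * k + 3) (by linarith) (by linarith)]
    rw [hflat k hk1 (2 * k + 2) ⟨by linarith, le_rfl⟩]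
    have : ∫ s in (2 * k + 2 : ℝ)..(2 * k + 3), -(afun s) * x (s - 1) =
        ∫ s in (2 * k + 2 : ℝ)..(2 * k + 3),
          (2 * (Real.sin (Real.pi * s))^2) * (-(x (2 * k + 1))) := by
      apply intervalIntegral.integral_congr
      intro s hs
      rw [uIcc_of_le (by linarith)] at hs
      have e1 := afun_eq (k + 1) s (by push_cast; linarith [hs.1]) (by push_cast; linarith [hs.2])
      have e2 := hflat k hk1 (s - 1) ⟨by linarith [hs.1], by linarith [hs.2]⟩
      simp only [e1, e2]; ring
    rw [this, intervalIntegral.integral_mul_const]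
    have e := sin_int (k + 1)
    push_cast at e
    have e' : (2 * ((k : ℝ) + 1)) = 2 * k + 2 := by ring
    have e'' : (2 * (k : ℝ) + 2 + 1) = 2 * k + 3 := by ring
    rw [e', e''] at e
    rw [e]; ring
  have hall : ∀ n : ℕ, ∀ t ∈ Icc (2 * k + 3 : ℝ) (2 * k + 4 + n), x t = 0 := by
    intro n
    induction n with
    | zero =>
      intro t ht
      have := hflat (k + 1) (by push_cast; linarith) t
        ⟨by push_cast; linarith [ht.1], by have := ht.2; push_cast at this ⊢; linarith⟩
      rw [this, ← h3]; congr 1; push_cast; ring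
    | succ n ih =>
      intro t ht
      have hn : (0 : ℝ) ≤ n := n.cast_nonneg
      have ht2 := ht.2
      push_cast at ht2
      rcases le_total t (2 * k + 4 + n) with h | h
      · exact ih t ⟨ht.1, h⟩
      · rw [x_step x t₀ hx (2 * k + 4 + n) t (by linarith) h,
          ih (2 * k + 4 + n) ⟨by linarith, le_rfl⟩]
        have : ∫ s in (2 * k + 4 + n : ℝ)..t, -(afun s) * x (s - 1) =
            ∫ s in (2 * k + 4 + n : ℝ)..t, (0 : ℝ) := by
          apply intervalIntegral.integral_congr
          intro s hs
          rw [uIcc_of_le h] at hs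
          simp [ih (s - 1) ⟨by linarith [hs.1], by linarith [hs.2]⟩]
        rw [this]; simp
  intro t ht
  obtain ⟨n, hn⟩ := exists_nat_ge t
  exact hall n t ⟨by linarith, by linarith [(k.cast_nonneg : (0 : ℝ) ≤ k)]⟩

/-- **Example 2.13.** The origin of the planar system
`ẋ(t) = -a(t) x(t-1)`, `ẏ(t) = -y(t) + d(t) eᵗ x(t)²`, `d ∈ M_{[-1,1]}`,
is non-uniformly in time RGAS. -/
theorem stmt15 :
    ∃ σ : ℝ → ℝ → ℝ, ∃ β : ℝ → ℝ, IsKL σ ∧ IsKPlus β ∧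
      ∀ t₀ : ℝ, 0 ≤ t₀ → ∀ d : ℝ → ℝ, MDs (Icc (-1) 1) d →
        ∀ x y : ℝ → ℝ, ContinuousOn x (Ici (t₀ - 1)) → ContinuousOn y (Ici (t₀ - 1)) →
          (∀ t, t₀ ≤ t →
            IntervalIntegrable (fun s => -(afun s) * x (s - 1)) volume t₀ t ∧
            x t = x t₀ + ∫ s in t₀..t, -(afun s) * x (s - 1)) →
          (∀ t, t₀ ≤ t →
            IntervalIntegrable (fun s => -(y s) + d s * Real.exp s * (x s)^2) volume t₀ t ∧
            y t = y t₀ + ∫ s in t₀..t, (-(y s) + d s * Real.exp s * (x s)^2)) →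
          ∀ t, t₀ ≤ t →
            sSup ((fun θ => Real.sqrt ((x (t + θ))^2 + (y (t + θ))^2)) '' Icc (-1) 0) ≤
              σ (β t₀ *
                  sSup ((fun θ => Real.sqrt ((x (t₀ + θ))^2 + (y (t₀ + θ))^2)) '' Icc (-1) 0))
                (t - t₀) := by
  refine ⟨fun s t => Real.exp (5 - t) * (82 * s + 52488 * Real.exp 4 * s ^ 2),
    fun t => Real.exp t, ⟨?_, ?_, ?_, ?_, ?_⟩, ⟨Real.continuous_exp.continuousOn,
    fun t _ => Real.exp_pos t⟩, ?_⟩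
  · exact Continuous.continuousOn (by fun_prop)
  · intro s t hs ht; positivity
  · intro t ht
    refine ⟨?_, by simp⟩
    intro u hu v hv huv
    have hu' : (0 : ℝ) ≤ u := hu
    have : u ^ 2 ≤ v ^ 2 := pow_le_pow_left₀ hu' huv.le 2
    apply mul_lt_mul_of_pos_left _ (Real.exp_pos _)
    have := mul_le_mul_of_nonneg_left this (by positivity : 0 ≤ 52488 * Real.exp 4)
    linarith
  · intro s hs u hu v hv huv
    apply mul_le_mul_of_nonneg_right
    · exact Real.exp_le_exp.2 (by linarith)
    · positivity
  · intro s hs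
    have h1 : Tendsto (fun t : ℝ => Real.exp (5 - t)) atTop (nhds 0) := by
      apply Real.tendsto_exp_atBot.comp
      exact tendsto_atBot_add_const_left _ _ tendsto_neg_atTop_atBot
    simpa using h1.mul_const (82 * s + 52488 * Real.exp 4 * s ^ 2)
  intro t₀ ht₀ d hd x y hxc hyc hx hy t ht
  set M := sSup ((fun θ => Real.sqrt ((x (t₀ + θ))^2 + (y (t₀ + θ))^2)) '' Icc (-1) 0) with hMdef
  have hbdd : BddAbove ((fun θ => Real.sqrt ((x (t₀ + θ))^2 + (y (t₀ + θ))^2)) '' Icc (-1) 0) := by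
    apply isCompact_Icc.bddAbove_image
    have hm : MapsTo (fun θ : ℝ => t₀ + θ) (Icc (-1) 0) (Ici (t₀ - 1)) := by
      intro θ hθ
      have := hθ.1
      simp only [mem_Ici]; linarith
    have ha : ContinuousOn (fun θ : ℝ => t₀ + θ) (Icc (-1) 0) := by fun_prop
    have h1 := hxc.comp ha hm
    have h2 := hyc.comp ha hm
    exact ((h1.pow 2).add (h2.pow 2)).sqrt
  have hM1 : ∀ t ∈ Icc (t₀ - 1) t₀, Real.sqrt ((x t)^2 + (y t)^2) ≤ M := by
    intro t ht
    apply le_csSup hbdd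
    exact ⟨t - t₀, ⟨by linarith [ht.1], by linarith [ht.2]⟩, by simp⟩
  have hM0 : 0 ≤ M := (Real.sqrt_nonneg _).trans (hM1 t₀ ⟨by linarith, le_rfl⟩)
  have hMx : ∀ t ∈ Icc (t₀ - 1) t₀, |x t| ≤ M := fun t ht =>
    (Real.abs_le_sqrt (by nlinarith [sq_nonneg (y t)])).trans (hM1 t ht)
  have hMy : ∀ t ∈ Icc (t₀ - 1) t₀, |y t| ≤ M := fun t ht =>
    (Real.abs_le_sqrt (by nlinarith [sq_nonneg (x t)])).trans (hM1 t ht)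
  have hxz := x_zero x t₀ ht₀ hx
  have hxb : ∀ t ∈ Icc (t₀ - 1) (t₀ + 4), |x t| ≤ 81 * M := by
    have := x_bound x t₀ M hM0 hx hMx 4
    norm_num at this
    intro t ht
    exact this t (by linarith [ht.1]) ht.2
  set C := 26244 * Real.exp (t₀ + 4) * M ^ 2 with hCdef
  have hC0 : 0 ≤ C := by positivity
  have hyint : ∀ u v, t₀ ≤ u → u ≤ v → IntervalIntegrable y volume u v := by
    intro u v hu hv
    apply ContinuousOn.intervalIntegrable
    apply hyc.mono
    rw [uIcc_of_le hv]
    intro s hs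
    have := hs.1
    simp only [mem_Ici]; linarith
  have hyg : ∀ u v, t₀ ≤ u → u ≤ v → y v - (y u - ∫ s in u..v, y s)
      = ∫ s in u..v, d s * Real.exp s * (x s)^2 := by
    intro u v hu hv
    have h1 := hy u hu
    have h2 := hy v (hu.trans hv)
    have h12 := h1.1.symm.trans h2.1
    have e : y v = y u + ∫ s in u..v, (-(y s) + d s * Real.exp s * (x s)^2) := by
      rw [h2.2, h1.2, ← intervalIntegral.integral_add_adjacent_intervals h1.1 h12]
      ring
    have e2 : ∫ s in u..v, d s * Real.exp s * (x s)^2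
        = ∫ s in u..v, ((-(y s) + d s * Real.exp s * (x s)^2) + y s) := by
      congr 1; ext s; ring
    rw [e2, intervalIntegral.integral_add h12 (hyint u v hu hv), e]
    ring
  have hy1 : ∀ t ∈ Icc t₀ (t₀ + 4), |y t| ≤ M + 2 * C := by
    intro t ht
    have := aux_y y t₀ (t₀ + 4) C hC0 (hyc.mono (Ici_subset_Ici.2 (by linarith))) (by
      intro t ht
      rw [hyg t₀ t le_rfl ht.1]
      have b : ‖∫ s in t₀..t, d s * Real.exp s * (x s)^2‖
          ≤ (Real.exp (t₀ + 4) * (81 * M) ^ 2) * |t - t₀| := by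
        apply intervalIntegral.norm_integral_le_of_norm_le_const
        intro s hs
        rw [uIoc_of_le ht.1] at hs
        have hds := hd.1 s (by linarith [hs.1])
        have hds' : |d s| ≤ 1 := abs_le.2 hds
        have hxs := hxb s ⟨by linarith [hs.1], hs.2.trans ht.2⟩
        have hes : Real.exp s ≤ Real.exp (t₀ + 4) := Real.exp_le_exp.2 (hs.2.trans ht.2)
        rw [Real.norm_eq_abs, abs_mul, abs_mul, Real.abs_exp, abs_pow]
        apply mul_le_mul _ (pow_le_pow_left₀ (abs_nonneg _) hxs 2) (by positivity) (by positivity)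
        calc |d s| * Real.exp s ≤ 1 * Real.exp s :=
              mul_le_mul_of_nonneg_right hds' (Real.exp_pos s).le
          _ ≤ _ := by rw [one_mul]; exact hes
      rw [Real.norm_eq_abs, abs_of_nonneg (by linarith [ht.1] : 0 ≤ t - t₀)] at b
      refine b.trans ?_
      have : t - t₀ ≤ 4 := by linarith [ht.2]
      refine (mul_le_mul_of_nonneg_left this (by positivity)).trans (le_of_eq ?_)
      rw [hCdef]; ring) t ht
    have h1 : Real.exp (-(t - t₀)) ≤ 1 := Real.exp_le_one_iff.2 (by linarith [ht.1])
    have h2 := hMy t₀ ⟨by linarith, le_rfl⟩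
    have h3 := mul_le_mul h1 h2 (abs_nonneg _) zero_le_one
    linarith
  have hy2 : ∀ t, t₀ + 4 ≤ t → |y t| ≤ Real.exp (-(t - (t₀ + 4))) * (M + 2 * C) := by
    intro t ht
    have := aux_y y (t₀ + 4) t 0 le_rfl (hyc.mono (Ici_subset_Ici.2 (by linarith))) (by
      intro v hv
      rw [hyg (t₀ + 4) v (by linarith) hv.1]
      have : ∫ s in (t₀ + 4)..v, d s * Real.exp s * (x s)^2 = ∫ s in (t₀ + 4)..v, (0 : ℝ) := by
        apply intervalIntegral.integral_congr
        intro s hs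
        rw [uIcc_of_le hv.1] at hs
        simp [hxz s hs.1]
      rw [this]; simp) t ⟨ht, le_rfl⟩
    have h1 := hy1 (t₀ + 4) ⟨by linarith, le_rfl⟩
    have h2 := mul_le_mul_of_nonneg_left h1 (Real.exp_pos (-(t - (t₀ + 4)))).le
    linarith
  have hyall : ∀ t, t₀ - 1 ≤ t → |y t| ≤ Real.exp (4 - (t - t₀)) * (M + 2 * C) := by
    intro t ht
    rcases le_total t (t₀ + 4) with h | h
    · have h1 : 1 ≤ Real.exp (4 - (t - t₀)) := Real.one_le_exp (by linarith)
      have h2 : |y t| ≤ M + 2 * C := by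
        rcases le_total t t₀ with h' | h'
        · have := hMy t ⟨ht, h'⟩
          linarith
        · exact hy1 t ⟨h', h⟩
      nlinarith
    · have := hy2 t h
      have e : -(t - (t₀ + 4)) = 4 - (t - t₀) := by ring
      rwa [e] at this
  have hxall : ∀ t, t₀ - 1 ≤ t → |x t| ≤ Real.exp (4 - (t - t₀)) * (81 * M) := by
    intro t ht
    rcases le_total t (t₀ + 4) with h | h
    · have h1 : 1 ≤ Real.exp (4 - (t - t₀)) := Real.one_le_exp (by linarith)
      have h2 := hxb t ⟨ht, h⟩
      nlinarith
    · rw [hxz t h]; simp; positivity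
  apply csSup_le
  · exact ⟨_, ⟨0, by simp, rfl⟩⟩
  rintro _ ⟨θ, hθ, rfl⟩
  have hθ1 := hθ.1
  have hθ2 := hθ.2
  have b1 := hxall (t + θ) (by linarith)
  have b2 := hyall (t + θ) (by linarith)
  have b3 : Real.sqrt ((x (t + θ))^2 + (y (t + θ))^2) ≤ |x (t + θ)| + |y (t + θ)| := by
    rw [Real.sqrt_le_left (by positivity)]
    have := sq_abs (x (t + θ))
    have := sq_abs (y (t + θ))
    nlinarith [mul_nonneg (abs_nonneg (x (t + θ))) (abs_nonneg (y (t + θ)))]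
  have b4 : Real.exp (4 - (t + θ - t₀)) ≤ Real.exp (5 - (t - t₀)) :=
    Real.exp_le_exp.2 (by linarith)
  have hE : 1 ≤ Real.exp t₀ := Real.one_le_exp ht₀
  have c1 : M ≤ Real.exp t₀ * M := by nlinarith
  have c2 : 2 * C ≤ 52488 * Real.exp 4 * (Real.exp t₀ * M) ^ 2 := by
    have : 2 * C = 52488 * Real.exp 4 * (Real.exp t₀ * M ^ 2) := by
      rw [hCdef, Real.exp_add]; ring
    rw [this]
    apply mul_le_mul_of_nonneg_left _ (by positivity)
    rw [mul_pow]
    apply mul_le_mul_of_nonneg_right _ (by positivity)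
    nlinarith
  calc Real.sqrt ((x (t + θ))^2 + (y (t + θ))^2)
      ≤ Real.exp (4 - (t + θ - t₀)) * (82 * M + 2 * C) := by linarith
    _ ≤ Real.exp (5 - (t - t₀)) * (82 * M + 2 * C) :=
        mul_le_mul_of_nonneg_right b4 (by positivity)
    _ ≤ _ := mul_le_mul_of_nonneg_left (by linarith) (Real.exp_pos _).le

end
end

section
/- Let a : [0,∞) → [0,∞) be of class K∞ (continuous, strictly increasing, unbounded, a(0) = 0). Define ā(s) := inf{ min{ y/2, a(y) } + |y − s| : y ≥ 0 } for s ≥ 0. Then: (1) ā is of class K∞; (2) ā is globally Lipschitz with unit Lipschitz constant, i.e. |ā(s₁) − ā(s₂)| ≤ |s₁ − s₂| for all s₁, s₂ ≥ 0; (3) ā(s) ≤ a(s) for all s ≥ 0. -/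
open Set Filter

noncomputable section

/-- Class `K∞` functions (on `[0,∞)`): continuous, strictly increasing, unbounded,
vanishing at `0`, non-negative. -/
def IsKInf (a : ℝ → ℝ) : Prop :=
  ContinuousOn a (Ici 0) ∧ StrictMonoOn a (Ici 0) ∧ a 0 = 0 ∧
  (∀ s, 0 ≤ s → 0 ≤ a s) ∧ Filter.Tendsto a Filter.atTop Filter.atTop

/-- The regularization `ā(s) = inf { min(y/2, a(y)) + |y - s| : y ≥ 0 }`. -/
def abar (a : ℝ → ℝ) (s : ℝ) : ℝ :=
  sInf ((fun y => min (y / 2) (a y) + |y - s|) '' Ici 0)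

theorem abar_le (a : ℝ → ℝ) (ha : IsKInf a) (s y : ℝ) (hy : 0 ≤ y) :
    abar a s ≤ min (y / 2) (a y) + |y - s| := by
  apply csInf_le
  · refine ⟨0, ?_⟩
    rintro _ ⟨z, hz, rfl⟩
    have hz' : (0:ℝ) ≤ z := hz
    have h1 := ha.2.2.2.1 z hz'
    have : 0 ≤ min (z / 2) (a z) := le_min (by linarith) h1
    have := abs_nonneg (z - s)
    simp only
    linarith
  · exact ⟨y, hy, rfl⟩

theorem min_strict (a : ℝ → ℝ) (ha : IsKInf a) (x y : ℝ) (hx : 0 ≤ x) (h : x < y) :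
    min (x / 2) (a x) < min (y / 2) (a y) := by
  have h1 := ha.2.1 (show x ∈ Ici 0 from hx) (show y ∈ Ici 0 from hx.trans h.le) h
  exact min_lt_min (by linarith) h1

theorem abar_attained (a : ℝ → ℝ) (ha : IsKInf a) (s : ℝ) (hs : 0 ≤ s) :
    ∃ y, 0 ≤ y ∧ y ≤ s ∧ abar a s = min (y / 2) (a y) + (s - y) := by
  have hc : ContinuousOn (fun y => min (y / 2) (a y) + (s - y)) (Icc 0 s) := by
    have := ha.1.mono (Icc_subset_Ici_self : Icc 0 s ⊆ Ici 0)
    fun_prop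
  obtain ⟨y, hy, hmin⟩ := isCompact_Icc.exists_isMinOn (nonempty_Icc.2 hs) hc
  have hmin' := isMinOn_iff.1 hmin
  refine ⟨y, hy.1, hy.2, le_antisymm ?_ ?_⟩
  · have := abar_le a ha s y hy.1
    rwa [abs_of_nonpos (by linarith [hy.2]), neg_sub] at this
  · apply le_csInf (Set.Nonempty.image _ nonempty_Ici)
    rintro _ ⟨z, hz, rfl⟩
    have hz' : (0:ℝ) ≤ z := hz
    rcases le_or_gt z s with h | h
    · have := hmin' z ⟨hz', h⟩
      have h2 := neg_abs_le (z - s)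
      simp only at this ⊢
      linarith
    · have := hmin' s ⟨hs, le_rfl⟩
      have h2 := abs_nonneg (z - s)
      have h3 := min_strict a ha s z hs h
      simp only at this ⊢
      linarith

theorem abar_lip (a : ℝ → ℝ) (ha : IsKInf a) (s t : ℝ) (ht : 0 ≤ t) :
    abar a s ≤ abar a t + |s - t| := by
  obtain ⟨y, h0, h1, h2⟩ := abar_attained a ha t ht
  have h3 := abar_le a ha s y h0
  have h4 : |y - s| ≤ (t - y) + |s - t| := by
    have := abs_sub_le y t s
    rw [abs_of_nonpos (by linarith : y - t ≤ 0), abs_sub_comm t s] at this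
    linarith
  linarith

/-- If `a ∈ K∞` then `ā(s) = inf { min(y/2, a(y)) + |y - s| : y ≥ 0 }`
is of class `K∞`, is globally Lipschitz on `[0,∞)` with unit Lipschitz constant, and
satisfies `ā ≤ a` on `[0,∞)`. -/
theorem stmt16 (a : ℝ → ℝ) (ha : IsKInf a) :
    IsKInf (abar a) ∧
    (∀ s₁ s₂, 0 ≤ s₁ → 0 ≤ s₂ → |abar a s₁ - abar a s₂| ≤ |s₁ - s₂|) ∧
    (∀ s, 0 ≤ s → abar a s ≤ a s) := by
  have hlip : ∀ s₁ s₂, 0 ≤ s₁ → 0 ≤ s₂ → |abar a s₁ - abar a s₂| ≤ |s₁ - s₂| := by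
    intro s t hs ht
    have h1 := abar_lip a ha s t ht
    have h2 := abar_lip a ha t s hs
    rw [abs_sub_comm t s] at h2
    exact abs_sub_le_iff.2 ⟨by linarith, by linarith⟩
  have hle : ∀ s, 0 ≤ s → abar a s ≤ min (s / 2) (a s) := by
    intro s hs
    simpa using abar_le a ha s s hs
  have hm0 : ∀ y, 0 ≤ y → 0 ≤ min (y / 2) (a y) := fun y hy =>
    le_min (by linarith) (ha.2.2.2.1 y hy)
  have hnn : ∀ s, 0 ≤ s → 0 ≤ abar a s := by
    intro s hs
    obtain ⟨y, h0, h1, h2⟩ := abar_attained a ha s hs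
    have := hm0 y h0
    linarith
  refine ⟨⟨?_, ?_, ?_, hnn, ?_⟩, hlip, fun s hs => (hle s hs).trans (min_le_right _ _)⟩
  · have : LipschitzOnWith 1 (abar a) (Ici 0) := by
      apply LipschitzOnWith.of_dist_le_mul
      intro x hx y hy
      simpa [Real.dist_eq] using hlip x y hx hy
    exact this.continuousOn
  · intro s hs t ht hst
    obtain ⟨y, h0, h1, h2⟩ := abar_attained a ha t ht
    rcases le_or_gt y s with h | h
    · have := abar_le a ha s y h0
      rw [abs_of_nonpos (by linarith)] at this
      linarith
    · have := hle s hs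
      have := min_strict a ha s y hs h
      linarith
  · have h1 := hle 0 le_rfl
    have h2 := hnn 0 le_rfl
    have h3 := min_le_left ((0:ℝ) / 2) (a 0)
    linarith
  · rw [tendsto_atTop]
    intro b
    have hh : Tendsto (fun s : ℝ => s / 2) atTop atTop :=
      tendsto_id.atTop_div_const (by norm_num)
    filter_upwards [eventually_ge_atTop 0, eventually_ge_atTop (4 * b),
      (tendsto_atTop.1 (ha.2.2.2.2.comp hh)) b] with s hs hb hab
    simp only [Function.comp] at hab
    obtain ⟨y, h0, h1, h2⟩ := abar_attained a ha s hs
    rcases le_or_gt y (s / 2) with h | h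
    · have := hm0 y h0
      linarith
    · have h3 := min_strict a ha (s / 2) y (by linarith) h
      have h4 : b ≤ min (s / 2 / 2) (a (s / 2)) := le_min (by linarith) hab
      linarith

end
end
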